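/- (Asymptotics of Meixner–Pollaczek polynomials at complex arguments.) Let z ∈ ℂ with Re z > 0 be fixed. Then lim_{n→∞} i^n Γ(1/2 + z) (2n)^{1/2 − z} P_n(−i z) = 1; equivalently, P_n(−i z) is asymptotic, as n → ∞, to (−i)^n (2n)^{z − 1/2} / Γ(1/2 + z). In particular, for every N ∈ ℕ, lim_{n→∞} i^n N! (2n)^{−N} P_n(−i(N + 1/2)) = 1. -/

import Mathlib

open Filter MeasureTheory

/-- Meixner–Pollaczek polynomials `P_n^{(1/2)}` at complex arguments, defined by the
recurrence `(n+1) P_{n+1}(y) = 2y P_n(y) - n P_{n-1}(y)`, `P_{-1} = 0`, `P_0 = 1`. -/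
noncomputable def MP : ℕ → ℂ → ℂ
  | 0, _ => 1
  | 1, y => 2 * y
  | (n+2), y => (2 * y * MP (n+1) y - (n+1 : ℂ) * MP n y) / (n+2 : ℂ)

/-- The coefficient of `t ^ k` in `(1 - t) ^ (-s)`, i.e. `s (s + 1) ⋯ (s + k - 1) / k!`. -/
noncomputable def risingCoeff (s : ℂ) (k : ℕ) : ℂ :=
  ∏ j ∈ Finset.range k, (s + j) / (j + 1)

lemma risingCoeff_succ (s : ℂ) (k : ℕ) :
    (k + 1 : ℂ) * risingCoeff s (k + 1) = (s + k) * risingCoeff s k := by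
  have h : (k + 1 : ℂ) ≠ 0 := by exact_mod_cast k.succ_ne_zero
  rw [risingCoeff, risingCoeff, Finset.prod_range_succ]
  field_simp

lemma risingCoeff_eq (s : ℂ) (k : ℕ) :
    risingCoeff s k = (∏ j ∈ Finset.range k, (s + j)) / (k.factorial : ℂ) := by
  rw [risingCoeff, Finset.prod_div_distrib, ← Finset.prod_range_add_one_eq_factorial]
  push_cast
  rfl

lemma tendsto_cpow_mul_risingCoeff {s : ℂ} (hs : ∀ m : ℕ, s ≠ -m) :
    Tendsto (fun k : ℕ => (k : ℂ) ^ (1 - s) * risingCoeff s k) atTop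
      (nhds (Complex.Gamma s)⁻¹) := by
  have h1 := (Complex.GammaSeq_tendsto_Gamma s).inv₀ (Complex.Gamma_ne_zero hs)
  have h2 : Tendsto (fun k : ℕ => (k : ℂ) / (k + s)) atTop (nhds 1) :=
    tendsto_natCast_div_add_atTop s
  have h3 := h1.mul h2
  rw [mul_one] at h3
  refine h3.congr' ?_
  filter_upwards [eventually_ne_atTop 0] with k hk
  have hk' : (k : ℂ) ≠ 0 := by exact_mod_cast hk
  have hsk : (k : ℂ) + s ≠ 0 := fun h => hs k (by linear_combination h)
  have hf : (k.factorial : ℂ) ≠ 0 := by exact_mod_cast k.factorial_ne_zero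
  have hc : (k : ℂ) ^ s ≠ 0 := by simp [Complex.cpow_eq_zero_iff, hk']
  rw [risingCoeff_eq, Complex.GammaSeq, Finset.prod_range_succ, Complex.cpow_sub _ _ hk',
    Complex.cpow_one, inv_div, add_comm s (k : ℂ)]
  field_simp

lemma exists_norm_risingCoeff_le (s : ℂ) :
    ∃ C : ℝ, 0 ≤ C ∧ ∀ k : ℕ, ‖risingCoeff s k‖ ≤ C * ((k : ℝ) + 1) ^ (s.re - 1) := by
  suffices h : ∃ C : ℝ, ∀ k : ℕ, ((k : ℝ) + 1) ^ (1 - s.re) * ‖risingCoeff s k‖ ≤ C by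
    obtain ⟨C, hC⟩ := h
    refine ⟨C, (by positivity : (0 : ℝ) ≤ _).trans (hC 0), fun k => ?_⟩
    have hk : (0 : ℝ) < (k : ℝ) + 1 := by positivity
    have h := mul_le_mul_of_nonneg_right (hC k) (Real.rpow_nonneg hk.le (s.re - 1))
    rwa [mul_right_comm, ← Real.rpow_add hk, show 1 - s.re + (s.re - 1) = 0 by ring,
      Real.rpow_zero, one_mul] at h
  suffices h : ∃ l : ℝ, Tendsto (fun k : ℕ => ((k : ℝ) + 1) ^ (1 - s.re) * ‖risingCoeff s k‖)
      atTop (nhds l) by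
    obtain ⟨l, hl⟩ := h
    obtain ⟨C, hC⟩ := hl.bddAbove_range
    exact ⟨C, fun k => hC ⟨k, rfl⟩⟩
  by_cases hs : ∀ m : ℕ, s ≠ -m
  · have h1 := (tendsto_cpow_mul_risingCoeff hs).norm
    have h2 : Tendsto (fun k : ℕ => ((((k : ℝ) + 1) / k) ^ (1 - s.re) : ℝ)) atTop (nhds 1) := by
      have := ((tendsto_natCast_div_add_atTop (1 : ℝ)).inv₀ one_ne_zero).rpow_const
        (p := 1 - s.re) (Or.inl (by simp))
      simpa using this
    refine ⟨_, (h2.mul h1).congr' ?_⟩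
    filter_upwards [eventually_gt_atTop 0] with k hk
    have hk' : (0 : ℝ) < k := by exact_mod_cast hk
    rw [norm_mul, Complex.norm_natCast_cpow_of_pos hk, Real.div_rpow (by positivity) hk'.le]
    have : (k : ℝ) ^ (1 - s.re) ≠ 0 := (Real.rpow_pos_of_pos hk' _).ne'
    simp only [Complex.sub_re, Complex.one_re]
    field_simp
  · push Not at hs
    obtain ⟨m, rfl⟩ := hs
    refine ⟨0, tendsto_const_nhds.congr' ?_⟩
    filter_upwards [eventually_gt_atTop m] with k hk
    have : risingCoeff (-m : ℂ) k = 0 :=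
      Finset.prod_eq_zero (Finset.mem_range.2 hk) (by simp)
    simp [this]

/-- The coefficients of `(1 - t ^ 2) ^ (-s)`. -/
noncomputable def evenRisingCoeff (s : ℂ) (m : ℕ) : ℂ :=
  if Even m then risingCoeff s (m / 2) else 0

lemma evenRisingCoeff_add_two (s : ℂ) (m : ℕ) :
    (m + 2 : ℂ) * evenRisingCoeff s (m + 2) = (2 * s + m) * evenRisingCoeff s m := by
  rcases Nat.even_or_odd m with h | h
  · obtain ⟨k, rfl⟩ := h
    have h2 := risingCoeff_succ s k
    simp only [evenRisingCoeff, Nat.even_add, even_two, ← two_mul, Nat.even_mul,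
      true_or, if_true, show (2 * k + 2) / 2 = k + 1 by lia, show 2 * k / 2 = k by lia]
    push_cast
    linear_combination 2 * h2
  · have h' : ¬ Even m := Nat.not_even_iff_odd.2 h
    simp [evenRisingCoeff, Nat.even_add, h']

lemma ringChoose_eq_neg_one_pow_mul (a : ℂ) (j : ℕ) :
    Ring.choose a j = (-1) ^ j * risingCoeff (-a) j := by
  have h : (ascPochhammer ℂ j).eval (-a) = ∏ i ∈ Finset.range j, (-a + i) := by
    induction j with
    | zero => simp
    | succ j ih => rw [ascPochhammer_succ_eval, ih, Finset.prod_range_succ]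
  have h2 := Polynomial.ascPochhammer_smeval_neg_eq_descPochhammer a j
  rw [Polynomial.ascPochhammer_smeval_eq_eval, h] at h2
  rw [Ring.choose_eq_smul, risingCoeff_eq, h2, smul_eq_mul, Int.negOnePow_def]
  rcases Nat.even_or_odd j with hj | hj <;> simp [hj.neg_one_pow, Units.smul_def] <;> ring

lemma ringChoose_succ (a : ℂ) (j : ℕ) :
    (j + 1 : ℂ) * Ring.choose a (j + 1) = (a - j) * Ring.choose a j := by
  rw [ringChoose_eq_neg_one_pow_mul, ringChoose_eq_neg_one_pow_mul]
  have := risingCoeff_succ (-a) j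
  linear_combination (-1) ^ (j + 1) * this

open PowerSeries in
lemma I_pow_mul_MP_eq_coeff (z : ℂ) (n : ℕ) :
    Complex.I ^ n * MP n (-Complex.I * z) =
      coeff n (PowerSeries.mk (Ring.choose (2 * z)) *
        PowerSeries.mk (evenRisingCoeff (1 / 2 + z))) := by
  set B := PowerSeries.mk (Ring.choose (2 * z)) with hB
  set A := PowerSeries.mk (evenRisingCoeff (1 / 2 + z)) with hA
  have hd (f : ℂ⟦X⟧) : constantCoeff (d⁄dX ℂ f) = coeff 1 f := by
    rw [← coeff_zero_eq_constantCoeff_apply, coeff_derivative]; simp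
  have hB' : (1 + X) * d⁄dX ℂ B = C (2 * z) * B := by
    ext n
    cases n with
    | zero =>
      simp [hB, add_mul, hd]
    | succ n =>
      have := ringChoose_succ (2 * z) (n + 1)
      simp only [hB, add_mul, one_mul, map_add, coeff_derivative, coeff_succ_X_mul, coeff_mk,
        coeff_C_mul]
      push_cast at this ⊢
      linear_combination this
  have hA' : (1 - X ^ 2) * d⁄dX ℂ A = C (1 + 2 * z) * X * A := by
    ext n
    rcases n with _ | _ | n
    · simp [hA, hd, evenRisingCoeff, sub_mul, mul_assoc]
    · have := evenRisingCoeff_add_two (1 / 2 + z) 0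
      simp only [zero_add, hA, coeff_derivative, sub_mul, one_mul, map_sub, mul_assoc,
        coeff_X_pow_mul', coeff_C_mul, coeff_mk, coeff_succ_X_mul 0] at this ⊢
      norm_num at this ⊢
      linear_combination this
    · have := evenRisingCoeff_add_two (1 / 2 + z) (n + 1)
      simp only [hA, coeff_derivative, sub_mul, one_mul, map_sub, mul_assoc, coeff_X_pow_mul,
        coeff_succ_X_mul, coeff_C_mul, coeff_mk, show n + 1 + 1 = n + 2 from rfl]
      push_cast at this ⊢
      linear_combination this
  set F := B * A with hF
  have hF' : (1 - X ^ 2) * d⁄dX ℂ F = (C (2 * z) + X) * F := by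
    rw [hF, Derivation.leibniz, smul_eq_mul, smul_eq_mul]
    have hC : C (1 + 2 * z) = 1 + C (2 * z) := by simp
    rw [hC] at hA'
    linear_combination B * hA' + (1 - X) * A * hB'
  have hrec (n : ℕ) : (n + 2 : ℂ) * coeff (n + 2) F = 2 * z * coeff (n + 1) F
      + (n + 1) * coeff n F := by
    have := congrArg (coeff (n + 1)) hF'
    rcases n with _ | n
    · simp [coeff_derivative, sub_mul, add_mul, coeff_X_pow_mul', coeff_succ_X_mul,
        mul_assoc] at this ⊢
      linear_combination this
    · simp only [coeff_derivative, sub_mul, add_mul, one_mul, map_sub, map_add, coeff_X_pow_mul,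
        coeff_succ_X_mul, coeff_C_mul, show n + 1 + 1 = n + 2 from rfl] at this
      push_cast at this ⊢
      linear_combination this
  have h0 : coeff 0 F = 1 := by simp [hF, hA, hB, evenRisingCoeff, risingCoeff]
  have h1 : coeff 1 F = 2 * z := by
    have := congrArg (coeff 0) hF'
    simp [hd, sub_mul, add_mul, mul_assoc] at this
    rw [coeff_zero_eq_constantCoeff_apply] at h0
    simpa [h0] using this
  have key : ∀ n, Complex.I ^ n * MP n (-Complex.I * z) = coeff n F ∧
      Complex.I ^ (n + 1) * MP (n + 1) (-Complex.I * z) = coeff (n + 1) F := by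
    intro n
    induction n with
    | zero =>
      refine ⟨by simp [MP, h0], ?_⟩
      simp only [zero_add, MP, h1]
      linear_combination -2 * z * Complex.I_sq
    | succ n ih =>
      refine ⟨ih.2, ?_⟩
      have hn : (n + 2 : ℂ) ≠ 0 := by exact_mod_cast (n + 1).succ_ne_zero
      apply mul_left_cancel₀ hn
      rw [hrec, ← ih.1, ← ih.2, MP]
      field_simp
      ring_nf
      simp only [Complex.I_sq, Complex.I_pow_three]
      ring
  exact (key n).1

lemma exists_norm_ringChoose_le (a : ℂ) :
    ∃ C : ℝ, 0 ≤ C ∧ ∀ j : ℕ, ‖Ring.choose a j‖ ≤ C * ((j : ℝ) + 1) ^ (-1 - a.re) := by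
  obtain ⟨C, hC, h⟩ := exists_norm_risingCoeff_le (-a)
  refine ⟨C, hC, fun j => ?_⟩
  rw [ringChoose_eq_neg_one_pow_mul, norm_mul, norm_pow, norm_neg, norm_one, one_pow, one_mul,
    show -1 - a.re = (-a).re - 1 by simp; ring]
  exact h j

lemma summable_norm_ringChoose {a : ℂ} (ha : 0 < a.re) :
    Summable fun j : ℕ => ‖Ring.choose a j‖ := by
  obtain ⟨C, -, h⟩ := exists_norm_ringChoose_le a
  refine Summable.of_nonneg_of_le (fun _ => norm_nonneg _) h (Summable.mul_left C ?_)
  have := (summable_nat_add_iff 1).2 (Real.summable_nat_rpow.2 (show -1 - a.re < -1 by linarith))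
  simpa using this

lemma tsum_ringChoose_mul_pow {a : ℂ} (ha : 0 < a.re) {t : ℝ} (ht : t ∈ Set.Icc (-1 : ℝ) 1) :
    ∑' j : ℕ, Ring.choose a j * (t : ℂ) ^ j = ((1 + t : ℝ) : ℂ) ^ a := by
  have hcl : Set.Icc (-1 : ℝ) 1 = closure (Set.Ioo (-1) 1) :=
    (closure_Ioo (by norm_num)).symm
  have hL : ContinuousOn (fun t : ℝ => ∑' j : ℕ, Ring.choose a j * (t : ℂ) ^ j)
      (Set.Icc (-1) 1) := by
    refine continuousOn_tsum (fun j => by fun_prop) (summable_norm_ringChoose ha) ?_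
    intro j x hx
    rw [norm_mul, norm_pow, Complex.norm_real]
    exact mul_le_of_le_one_right (norm_nonneg _)
      (pow_le_one₀ (norm_nonneg _) (abs_le.2 hx))
  have hR : ContinuousOn (fun t : ℝ => ((1 + t : ℝ) : ℂ) ^ a) (Set.Icc (-1) 1) := by
    refine Continuous.continuousOn (continuous_iff_continuousAt.2 fun x => ?_)
    exact (Complex.continuousAt_ofReal_cpow (1 + x) a (Or.inl ha)).comp
      (f := fun t : ℝ => ((1 + t, a) : ℝ × ℂ)) (by fun_prop)
  have hE : Set.EqOn (fun t : ℝ => ∑' j : ℕ, Ring.choose a j * (t : ℂ) ^ j)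
      (fun t : ℝ => ((1 + t : ℝ) : ℂ) ^ a) (Set.Ioo (-1) 1) := by
    intro x hx
    have hx' : (x : ℂ) ∈ Metric.eball (0 : ℂ) 1 := by
      have : |x| < 1 := abs_lt.2 hx
      simpa [← ofReal_norm, enorm_eq_nnnorm] using this
    have := (Complex.one_add_cpow_hasFPowerSeriesOnBall_zero (a := a)).hasSum hx'
    simp only [binomialSeries_apply, List.ofFn_const, List.prod_replicate, smul_eq_mul,
      zero_add] at this
    simpa using this.tsum_eq
  rw [hcl] at hL hR ht
  exact hE.of_subset_closure hL hR subset_closure subset_rfl ht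

lemma tsum_ringChoose {a : ℂ} (ha : 0 < a.re) : ∑' j : ℕ, Ring.choose a j = 2 ^ a := by
  have := tsum_ringChoose_mul_pow ha (t := 1) (by norm_num)
  norm_num at this
  exact this

lemma tsum_neg_one_pow_mul_ringChoose {a : ℂ} (ha : 0 < a.re) :
    ∑' j : ℕ, Ring.choose a j * (-1) ^ j = 0 := by
  have := tsum_ringChoose_mul_pow ha (t := -1) (by norm_num)
  have ha0 : a ≠ 0 := fun h => by simp [h] at ha
  simpa [ha0] using this

lemma tsum_ringChoose_parity {a : ℂ} (ha : 0 < a.re) (n : ℕ) :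
    ∑' j : ℕ, Ring.choose a j * ((1 + (-1) ^ (n + j)) / 2) = 2 ^ a / 2 := by
  have hs : Summable fun j : ℕ => Ring.choose a j := (summable_norm_ringChoose ha).of_norm
  have hs' : Summable fun j : ℕ => Ring.choose a j * (-1) ^ j :=
    Summable.of_norm (by simpa using summable_norm_ringChoose ha)
  have h : ∀ j : ℕ, Ring.choose a j * ((1 + (-1) ^ (n + j)) / 2) =
      Ring.choose a j / 2 + (-1) ^ n / 2 * (Ring.choose a j * (-1) ^ j) := fun j => by ring
  simp_rw [h]
  rw [(hs.div_const 2).tsum_add (hs'.mul_left _), tsum_div_const, tsum_mul_left,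
    tsum_ringChoose ha, tsum_neg_one_pow_mul_ringChoose ha]
  ring

lemma tendsto_evenRisingCoeff {z : ℂ} (hz : 0 < z.re) :
    Tendsto (fun m : ℕ => Complex.Gamma (1 / 2 + z) * (2 * (m : ℂ)) ^ (1 / 2 - z) *
      evenRisingCoeff (1 / 2 + z) m - 2 ^ (1 - 2 * z) * ((1 + (-1) ^ m) / 2)) atTop (nhds 0) := by
  have hs : ∀ m : ℕ, 1 / 2 + z ≠ -m := fun m h => by
    have := congrArg Complex.re h
    norm_num at this
    have : (0 : ℝ) ≤ m := m.cast_nonneg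
    linarith
  have hG := Complex.Gamma_ne_zero hs
  have h1 : Tendsto (fun k : ℕ => 2 ^ (1 - 2 * z) * (Complex.Gamma (1 / 2 + z) *
      ((k : ℂ) ^ (1 / 2 - z) * risingCoeff (1 / 2 + z) k)) - 2 ^ (1 - 2 * z)) atTop (nhds 0) := by
    have := ((tendsto_cpow_mul_risingCoeff hs).const_mul (Complex.Gamma (1 / 2 + z))).const_mul
      ((2 : ℂ) ^ (1 - 2 * z)) |>.sub_const ((2 : ℂ) ^ (1 - 2 * z))
    rw [mul_inv_cancel₀ hG, mul_one, sub_self] at this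
    rwa [show 1 - (1 / 2 + z) = 1 / 2 - z by ring] at this
  have h2 := (h1.comp (Nat.tendsto_div_const_atTop two_ne_zero)).norm
  rw [norm_zero] at h2
  refine squeeze_zero_norm (fun m => ?_) h2
  rcases Nat.even_or_odd m with h | h
  · obtain ⟨k, rfl⟩ := h.two_dvd
    refine le_of_eq (congrArg _ ?_)
    have h4 : (2 * ((2 * k : ℕ) : ℂ)) ^ (1 / 2 - z) =
        2 ^ (1 - 2 * z) * (k : ℂ) ^ (1 / 2 - z) := by
      have h5 := Complex.natCast_mul_natCast_cpow 2 (2 * k) (1 / 2 - z)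
      have h6 := Complex.natCast_mul_natCast_cpow 2 k (1 / 2 - z)
      push_cast at h5 h6 ⊢
      rw [h5, h6, ← mul_assoc, ← Complex.cpow_add _ _ two_ne_zero]
      ring_nf
    simp only [Function.comp, Nat.mul_div_cancel_left k two_pos, evenRisingCoeff, h, if_true, h4,
      h.neg_one_pow]
    ring
  · simp [evenRisingCoeff, Nat.not_even_iff_odd.2 h, h.neg_one_pow]

lemma norm_one_add_neg_one_pow_div_two_le (m : ℕ) : ‖((1 + (-1) ^ m) / 2 : ℂ)‖ ≤ 1 := by
  rcases neg_one_pow_eq_or ℂ m with h | h <;> norm_num [h]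

lemma tendsto_evenRisingCoeff_sub {z : ℂ} (hz : 0 < z.re) (j : ℕ) :
    Tendsto (fun n : ℕ => Complex.Gamma (1 / 2 + z) * (2 * (n : ℂ)) ^ (1 / 2 - z) *
      evenRisingCoeff (1 / 2 + z) (n - j) - 2 ^ (1 - 2 * z) * ((1 + (-1) ^ (n + j)) / 2))
      atTop (nhds 0) := by
  rw [← tendsto_add_atTop_iff_nat j]
  have hr : Tendsto (fun m : ℕ => ((((m : ℝ) + j) / m : ℝ) : ℂ) ^ (1 / 2 - z)) atTop (nhds 1) := by
    have h1 : Tendsto (fun m : ℕ => ((m : ℝ) + j) / m) atTop (nhds 1) := by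
      simpa using (tendsto_natCast_div_add_atTop (j : ℝ)).inv₀ one_ne_zero
    have h2 := (Complex.continuous_ofReal.tendsto 1).comp h1
    simpa using h2.cpow (tendsto_const_nhds (x := 1 / 2 - z)) (by simp)
  have hp : ∀ m : ℕ, ‖(2 : ℂ) ^ (1 - 2 * z) * ((1 + (-1) ^ m) / 2)‖ ≤ ‖(2 : ℂ) ^ (1 - 2 * z)‖ := by
    intro m
    rw [norm_mul]
    exact mul_le_of_le_one_right (norm_nonneg _) (norm_one_add_neg_one_pow_div_two_le m)
  have h3 : Tendsto (fun m : ℕ => (((((m : ℝ) + j) / m : ℝ) : ℂ) ^ (1 / 2 - z) - 1) *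
      ((2 : ℂ) ^ (1 - 2 * z) * ((1 + (-1) ^ m) / 2))) atTop (nhds 0) := by
    have h4 := ((hr.sub_const 1).norm).mul_const ‖(2 : ℂ) ^ (1 - 2 * z)‖
    rw [sub_self, norm_zero, zero_mul] at h4
    refine squeeze_zero_norm (fun m => ?_) h4
    rw [norm_mul]
    exact mul_le_mul_of_nonneg_left (hp m) (norm_nonneg _)
  have h5 := (hr.mul (tendsto_evenRisingCoeff hz)).add h3
  rw [mul_zero, add_zero] at h5
  refine h5.congr' ?_
  filter_upwards [eventually_gt_atTop 0] with m hm
  have hm' : (0 : ℝ) < m := by exact_mod_cast hm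
  have h6 : (2 * ((m + j : ℕ) : ℂ)) ^ (1 / 2 - z) =
      ((((m : ℝ) + j) / m : ℝ) : ℂ) ^ (1 / 2 - z) * (2 * (m : ℂ)) ^ (1 / 2 - z) := by
    have := Complex.mul_cpow_ofReal_nonneg (a := ((m : ℝ) + j) / m) (b := 2 * m) (by positivity)
      (by positivity) (1 / 2 - z)
    have hmC : (m : ℂ) ≠ 0 := by exact_mod_cast hm.ne'
    push_cast at this ⊢
    rw [← this]
    congr 1
    field_simp
  have h7 : (-1 : ℂ) ^ (m + j + j) = (-1) ^ m := by
    rw [add_assoc, pow_add, (Even.add_self j).neg_one_pow, mul_one]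
  rw [h6, h7, Nat.add_sub_cancel]
  ring

lemma exists_norm_evenRisingCoeff_sub_le {z : ℂ} (hz : 0 < z.re) :
    ∃ C : ℝ, 0 ≤ C ∧ ∀ n j : ℕ, 0 < n → j ≤ n →
      ‖Complex.Gamma (1 / 2 + z) * (2 * (n : ℂ)) ^ (1 / 2 - z) *
        evenRisingCoeff (1 / 2 + z) (n - j)‖ ≤ C * (√n / √((n - j : ℕ) + 1)) := by
  obtain ⟨C, hC, h⟩ := exists_norm_risingCoeff_le (1 / 2 + z)
  refine ⟨‖Complex.Gamma (1 / 2 + z)‖ * C * 2, by positivity, fun n j hn hj => ?_⟩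
  have hn' : (1 : ℝ) ≤ n := by exact_mod_cast hn
  have hpow : ‖(2 * (n : ℂ)) ^ (1 / 2 - z)‖ = √(2 * n) * (2 * (n : ℝ)) ^ (-z.re) := by
    have h1 := Complex.norm_natCast_cpow_of_pos (n := 2 * n) (by lia) (1 / 2 - z)
    push_cast at h1
    rw [h1, Real.sqrt_eq_rpow, ← Real.rpow_add (by positivity)]
    congr 1
    norm_num
    ring
  obtain ⟨m, hm⟩ : ∃ m, m = n - j := ⟨_, rfl⟩
  rw [← hm]
  have hmn : m ≤ n := by lia
  have hE : ‖evenRisingCoeff (1 / 2 + z) m‖ ≤ C * ((2 * n) ^ z.re * (√2 / √(m + 1))) := by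
    rw [evenRisingCoeff]
    split_ifs with he
    · obtain ⟨k, rfl⟩ := he.two_dvd
      rw [Nat.mul_div_cancel_left k two_pos]
      refine (h k).trans (mul_le_mul_of_nonneg_left ?_ hC)
      have hk : (0 : ℝ) < k + 1 := by positivity
      have hkn : (k : ℝ) + 1 ≤ 2 * n := by
        have : k + 1 ≤ 2 * n := by lia
        exact_mod_cast this
      have hre : (1 / 2 + z).re - 1 = z.re + (-(1 / 2)) := by
        norm_num
        ring
      rw [hre, Real.rpow_add hk, Real.rpow_neg hk.le, ← Real.sqrt_eq_rpow]
      refine mul_le_mul (Real.rpow_le_rpow hk.le hkn hz.le) ?_ (by positivity) (by positivity)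
      rw [inv_le_comm₀ (by positivity) (by positivity), inv_div,
        div_le_iff₀ (by positivity), ← Real.sqrt_mul hk.le]
      refine Real.sqrt_le_sqrt ?_
      push_cast
      linarith
    · rw [norm_zero]
      positivity
  rw [norm_mul, norm_mul, hpow]
  have h2n : (0 : ℝ) < 2 * n := by positivity
  calc _ ≤ ‖Complex.Gamma (1 / 2 + z)‖ * (√(2 * n) * (2 * (n : ℝ)) ^ (-z.re)) *
        (C * ((2 * n) ^ z.re * (√2 / √(m + 1)))) := by gcongr
    _ = ‖Complex.Gamma (1 / 2 + z)‖ * C * ((√2 * √2) * (√n / √(m + 1))) *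
        ((2 * (n : ℝ)) ^ (-z.re) * (2 * n) ^ z.re) := by
      rw [Real.sqrt_mul zero_le_two]
      ring
    _ = _ := by
      rw [← Real.rpow_add h2n, neg_add_cancel, Real.rpow_zero, Real.mul_self_sqrt zero_le_two]
      ring

lemma sum_range_inv_sqrt_le (n : ℕ) :
    ∑ k ∈ Finset.range n, (√((k : ℝ) + 1))⁻¹ ≤ 2 * √n := by
  induction n with
  | zero => simp
  | succ n ih =>
    rw [Finset.sum_range_succ]
    push_cast
    have h1 : 0 < √((n : ℝ) + 1) := by positivity
    have h2 := Real.sq_sqrt (show (0 : ℝ) ≤ (n : ℝ) + 1 by positivity)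
    have h3 := Real.sq_sqrt (show (0 : ℝ) ≤ (n : ℝ) by positivity)
    have h4 : (√((n : ℝ) + 1))⁻¹ ≤ 2 * √((n : ℝ) + 1) - 2 * √n := by
      rw [inv_le_iff_one_le_mul₀ h1]
      nlinarith [sq_nonneg (√((n : ℝ) + 1) - √n)]
    linarith

lemma tendsto_sum_tail {z : ℂ} (hz : 0 < z.re) :
    Tendsto (fun n : ℕ => ∑ j ∈ Finset.range (n + 1) with n < 2 * j, Ring.choose (2 * z) j *
      (Complex.Gamma (1 / 2 + z) * (2 * (n : ℂ)) ^ (1 / 2 - z) *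
        evenRisingCoeff (1 / 2 + z) (n - j))) atTop (nhds 0) := by
  obtain ⟨C, hC, h⟩ := exists_norm_evenRisingCoeff_sub_le hz
  obtain ⟨D, hD, h'⟩ := exists_norm_ringChoose_le (2 * z)
  have hre : (2 * z).re = 2 * z.re := by simp
  rw [hre] at h'
  have hlim : Tendsto (fun n : ℕ => D * C * 8 * ((n : ℝ) / 2) ^ (-(2 * z.re))) atTop (nhds 0) := by
    have := ((tendsto_rpow_neg_atTop (show 0 < 2 * z.re by linarith)).comp
      (tendsto_natCast_atTop_atTop.atTop_div_const (two_pos (α := ℝ)))).const_mul (D * C * 8)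
    simpa using this
  refine squeeze_zero_norm' ?_ hlim
  filter_upwards [eventually_gt_atTop 0] with n hn
  have hn' : (1 : ℝ) ≤ n := by exact_mod_cast hn
  have hn2 : (0 : ℝ) < n / 2 := by positivity
  have hterm : ∀ j ∈ (Finset.range (n + 1)).filter (n < 2 * ·), ‖Ring.choose (2 * z) j *
      (Complex.Gamma (1 / 2 + z) * (2 * (n : ℂ)) ^ (1 / 2 - z) *
        evenRisingCoeff (1 / 2 + z) (n - j))‖ ≤
      D * ((n : ℝ) / 2) ^ (-1 - 2 * z.re) * (C * (√n / √((n - j : ℕ) + 1))) := by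
    intro j hj
    rw [Finset.mem_filter, Finset.mem_range] at hj
    rw [norm_mul]
    refine mul_le_mul ((h' j).trans (mul_le_mul_of_nonneg_left ?_ hD)) (h n j hn (by lia))
      (norm_nonneg _) (by positivity)
    refine Real.rpow_le_rpow_of_nonpos hn2 ?_ (by linarith)
    have : (n : ℝ) < 2 * j := by exact_mod_cast hj.2
    linarith
  have hsum : ∑ j ∈ Finset.range (n + 1), (√(((n - j : ℕ) : ℝ) + 1))⁻¹ ≤ 4 * √n := by
    have h1 := Finset.sum_range_reflect (fun k : ℕ => (√((k : ℝ) + 1))⁻¹) (n + 1)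
    simp only [Nat.add_sub_cancel] at h1
    rw [h1]
    refine (sum_range_inv_sqrt_le (n + 1)).trans ?_
    have : √((n + 1 : ℕ) : ℝ) ≤ 2 * √n := by
      rw [Real.sqrt_le_left (by positivity), mul_pow, Real.sq_sqrt (by positivity)]
      push_cast
      linarith
    linarith
  calc _ ≤ ∑ j ∈ Finset.range (n + 1) with n < 2 * j,
        D * ((n : ℝ) / 2) ^ (-1 - 2 * z.re) * (C * (√n / √((n - j : ℕ) + 1))) :=
        norm_sum_le_of_le _ hterm
    _ ≤ ∑ j ∈ Finset.range (n + 1),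
        D * ((n : ℝ) / 2) ^ (-1 - 2 * z.re) * (C * (√n / √((n - j : ℕ) + 1))) :=
        Finset.sum_le_sum_of_subset_of_nonneg (Finset.filter_subset _ _)
          fun _ _ _ => by positivity
    _ = D * ((n : ℝ) / 2) ^ (-1 - 2 * z.re) * C * √n *
        ∑ j ∈ Finset.range (n + 1), (√(((n - j : ℕ) : ℝ) + 1))⁻¹ := by
      rw [Finset.mul_sum]
      exact Finset.sum_congr rfl fun j _ => by ring
    _ ≤ D * ((n : ℝ) / 2) ^ (-1 - 2 * z.re) * C * √n * (4 * √n) := by gcongr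
    _ = D * C * 8 * (((n : ℝ) / 2) ^ (-1 - 2 * z.re) * ((n : ℝ) / 2)) := by
      linear_combination 4 * D * ((n : ℝ) / 2) ^ (-1 - 2 * z.re) * C *
        Real.mul_self_sqrt (show (0 : ℝ) ≤ n by positivity)
    _ = _ := by
      rw [← Real.rpow_add_one hn2.ne']
      ring_nf

lemma tendsto_tsum_head {z : ℂ} (hz : 0 < z.re) :
    Tendsto (fun n : ℕ => ∑' j : ℕ, Ring.choose (2 * z) j *
      ((if 2 * j ≤ n then Complex.Gamma (1 / 2 + z) * (2 * (n : ℂ)) ^ (1 / 2 - z) *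
        evenRisingCoeff (1 / 2 + z) (n - j) else 0) -
          2 ^ (1 - 2 * z) * ((1 + (-1) ^ (n + j)) / 2))) atTop (nhds 0) := by
  obtain ⟨C, hC, h⟩ := exists_norm_evenRisingCoeff_sub_le hz
  have hsum := summable_norm_ringChoose (a := 2 * z) (by simpa using hz)
  rw [show nhds (0 : ℂ) = nhds (∑' _ : ℕ, 0) by rw [tsum_zero]]
  refine tendsto_tsum_of_dominated_convergence
    (hsum.mul_right (C * 2 + ‖(2 : ℂ) ^ (1 - 2 * z)‖)) (fun j => ?_) ?_
  · have h1 := (tendsto_evenRisingCoeff_sub hz j).const_mul (Ring.choose (2 * z) j)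
    rw [mul_zero] at h1
    refine h1.congr' ?_
    filter_upwards [eventually_ge_atTop (2 * j)] with n hn
    rw [if_pos hn]
  · filter_upwards [eventually_gt_atTop 0] with n hn j
    rw [norm_mul]
    refine mul_le_mul_of_nonneg_left ((norm_sub_le _ _).trans (add_le_add ?_ ?_)) (norm_nonneg _)
    · split_ifs with hj
      · refine (h n j hn (by lia)).trans (mul_le_mul_of_nonneg_left ?_ hC)
        rw [div_le_iff₀ (by positivity), Real.sqrt_le_left (by positivity), mul_pow,
          Real.sq_sqrt (by positivity)]
        have : n ≤ 4 * (n - j + 1) := by lia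
        norm_num
        exact_mod_cast this
      · rw [norm_zero]
        positivity
    · rw [norm_mul]
      exact mul_le_of_le_one_right (norm_nonneg _) (norm_one_add_neg_one_pow_div_two_le _)

lemma tendsto_I_pow_mul_MP {z : ℂ} (hz : 0 < z.re) :
    Tendsto (fun n : ℕ => Complex.I ^ n * Complex.Gamma (1 / 2 + z) *
      ((2 * (n : ℂ)) ^ ((1 / 2 : ℂ) - z)) * MP n (-Complex.I * z)) atTop (nhds 1) := by
  have ha : 0 < (2 * z).re := by simpa using hz
  have hlim := ((tendsto_tsum_head hz).add (tendsto_sum_tail hz)).add_const 1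
  rw [add_zero, zero_add] at hlim
  refine hlim.congr fun n => ?_
  set W : ℕ → ℂ := fun j => Complex.Gamma (1 / 2 + z) * (2 * (n : ℂ)) ^ (1 / 2 - z) *
    evenRisingCoeff (1 / 2 + z) (n - j) with hW
  have hsupp : ∀ j ∉ Finset.range (n + 1),
      Ring.choose (2 * z) j * (if 2 * j ≤ n then W j else 0) = 0 := by
    intro j hj
    rw [Finset.mem_range] at hj
    rw [if_neg (by lia), mul_zero]
  have hpar : Summable fun j : ℕ =>
      Ring.choose (2 * z) j * (2 ^ (1 - 2 * z) * ((1 + (-1) ^ (n + j)) / 2)) := by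
    refine Summable.of_norm_bounded
      ((summable_norm_ringChoose ha).mul_right ‖(2 : ℂ) ^ (1 - 2 * z)‖) fun j => ?_
    rw [norm_mul, norm_mul]
    exact mul_le_mul_of_nonneg_left (mul_le_of_le_one_right (norm_nonneg _)
      (norm_one_add_neg_one_pow_div_two_le _)) (norm_nonneg _)
  have hpsum : ∑' j : ℕ, Ring.choose (2 * z) j *
      (2 ^ (1 - 2 * z) * ((1 + (-1) ^ (n + j)) / 2)) = 1 := by
    simp_rw [mul_left_comm]
    rw [tsum_mul_left, tsum_ringChoose_parity ha, ← mul_div_assoc,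
      ← Complex.cpow_add _ _ two_ne_zero, sub_add_cancel, Complex.cpow_one, div_self two_ne_zero]
  have hMP : Complex.I ^ n * MP n (-Complex.I * z) = ∑ j ∈ Finset.range (n + 1),
      Ring.choose (2 * z) j * evenRisingCoeff (1 / 2 + z) (n - j) := by
    rw [I_pow_mul_MP_eq_coeff, PowerSeries.coeff_mul,
      Finset.Nat.sum_antidiagonal_eq_sum_range_succ_mk]
    simp
  simp_rw [mul_sub]
  rw [(summable_of_ne_finset_zero hsupp).tsum_sub hpar, hpsum, tsum_eq_sum hsupp,
    Finset.sum_filter, add_right_comm, sub_add_cancel, ← Finset.sum_add_distrib]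
  trans ∑ j ∈ Finset.range (n + 1), Ring.choose (2 * z) j * W j
  · refine Finset.sum_congr rfl fun j _ => ?_
    by_cases hj : 2 * j ≤ n
    · simp [hj, not_lt.2 hj]
    · rw [if_neg hj, if_pos (not_le.1 hj), mul_zero, zero_add]
  · rw [show ∀ a b c d : ℂ, a * b * c * d = b * c * (a * d) by intros; ring, hMP, Finset.mul_sum]
    exact Finset.sum_congr rfl fun j _ => by simp only [hW]; ring

/-- Asymptotics of Meixner–Pollaczek polynomials at complex arguments: for fixed `z`
with `Re z > 0`, `i^n Γ(1/2 + z) (2n)^{1/2 - z} P_n(-iz) → 1` as `n → ∞`, i.e.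
`P_n(-iz) ~ (-i)^n (2n)^{z - 1/2} / Γ(1/2 + z)`; in particular, for every `N ∈ ℕ`,
`i^n N! (2n)^{-N} P_n(-i(N + 1/2)) → 1`. -/
theorem MP_asymptotics (z : ℂ) (hz : 0 < z.re) :
    Filter.Tendsto (fun n : ℕ =>
        Complex.I ^ n * Complex.Gamma (1/2 + z) * ((2 * (n : ℂ)) ^ ((1/2 : ℂ) - z)) *
          MP n (-Complex.I * z))
      Filter.atTop (nhds 1) ∧
    ∀ N : ℕ, Filter.Tendsto (fun n : ℕ =>
        Complex.I ^ n * (N.factorial : ℂ) * ((2 * (n : ℂ)) ^ (-(N : ℂ))) *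
          MP n (-Complex.I * ((N : ℂ) + 1/2)))
      Filter.atTop (nhds 1) := by
  refine ⟨tendsto_I_pow_mul_MP hz, fun N => ?_⟩
  have hN : 0 < ((N : ℂ) + 1 / 2).re := by
    have : (0 : ℝ) ≤ N := N.cast_nonneg
    norm_num
    linarith
  have h := tendsto_I_pow_mul_MP hN
  rw [show (1 / 2 : ℂ) + (N + 1 / 2) = N + 1 by ring, Complex.Gamma_nat_eq_factorial,
    show (1 / 2 : ℂ) - (N + 1 / 2) = -N by ring] at h
  exact h
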